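/- arXiv:2212.06127 — 3 statements merged into one kernel-verified Lean document; each statement's English description precedes it below -/
import Mathlib

section
/- Let n be a positive integer and m an integer with m not a perfect square. Then √m belongs to the cyclotomic field ℚ(ζ_n) if and only if the discriminant of the quadratic field ℚ(√m) divides n. -/
open NumberField

/-- Divisibility of rational integers descends from the ring of integers of a number field. -/
theorem NumberField.RingOfIntegers.int_dvd_of_dvd {K : Type*} [Field K] [NumberField K] {a b : ℤ}
    (h : (a : 𝓞 K) ∣ (b : 𝓞 K)) : a ∣ b := by
  have h' := map_dvd (Algebra.norm ℤ) h
  rw [← eq_intCast (algebraMap ℤ (𝓞 K)) a, ← eq_intCast (algebraMap ℤ (𝓞 K)) b,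
    Algebra.norm_algebraMap, Algebra.norm_algebraMap] at h'
  exact (Int.pow_dvd_pow_iff Module.finrank_pos.ne').mp h'

/-- If two iterates of Frobenius modulo `p` agree on a generator, then they agree everywhere. -/
theorem dvd_pow_sub_pow_of_adjoin_singleton {R : Type*} [CommRing R] {p : ℕ} [Fact p.Prime]
    {a b : ℕ} {z : R} (hz : Algebra.adjoin ℤ {z} = ⊤) (h : (p : R) ∣ z ^ p ^ a - z ^ p ^ b)
    (x : R) : (p : R) ∣ x ^ p ^ a - x ^ p ^ b := by
  by_cases hp : IsUnit (p : R)
  · exact hp.dvd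
  have : CharP (R ⧸ Ideal.span {(p : R)}) p := CharP.quotient R p hp
  let F (c : ℕ) : R →ₐ[ℤ] R ⧸ Ideal.span {(p : R)} :=
    ((iterateFrobenius _ p c).comp (Ideal.Quotient.mk _)).toIntAlgHom
  have hF (y : R) : F a y = F b y ↔ (p : R) ∣ y ^ p ^ a - y ^ p ^ b := by
    change Ideal.Quotient.mk _ y ^ p ^ a = Ideal.Quotient.mk _ y ^ p ^ b ↔ _
    rw [← map_pow, ← map_pow, Ideal.Quotient.eq, Ideal.mem_span_singleton]
  have : F a = F b := AlgHom.ext_of_adjoin_eq_top hz (by simpa [Set.EqOn, hF] using h)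
  rw [← hF, this]

theorem exists_pow_prime_pow_eq_self {R : Type*} [Monoid R] {n p : ℕ} (hp : p.Prime)
    (hn : ¬ p ∣ n) {z : R} (hz : z ^ n = 1) : ∃ f ≠ 0, z ^ p ^ f = z := by
  have hc : Nat.Coprime p n := (hp.coprime_iff_not_dvd).mpr hn
  refine ⟨n.totient, (Nat.totient_pos.mpr (Nat.pos_of_ne_zero ?_)).ne', ?_⟩
  · rintro rfl
    simp at hn
  · rw [pow_eq_pow_mod _ hz, Nat.ModEq.pow_totient hc, ← pow_eq_pow_mod _ hz, pow_one]

theorem exists_two_dvd_pow_two_pow_sub_self {R : Type*} [CommRing R] [IsDomain R] {n : ℕ}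
    (hn : ¬ 4 ∣ n) {z : R} (hz : z ^ n = 1) : ∃ f ≠ 0, (2 : R) ∣ z ^ 2 ^ f - z := by
  obtain ⟨k, hk, hnk⟩ : ∃ k, ¬ 2 ∣ k ∧ n ∣ 2 * k := by
    by_cases h : 2 ∣ n
    · obtain ⟨k, rfl⟩ := h
      exact ⟨k, by omega, dvd_rfl⟩
    · exact ⟨n, h, dvd_mul_left _ _⟩
  obtain ⟨c, hc⟩ := hnk
  have hzk : (z ^ 2) ^ k = 1 := by rw [← pow_mul, hc, pow_mul, hz, one_pow]
  obtain ⟨f, hf, h⟩ := exists_pow_prime_pow_eq_self Nat.prime_two hk hzk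
  refine ⟨f, hf, ?_⟩
  rw [← pow_mul, mul_comm, pow_mul] at h
  rcases sq_eq_sq_iff_eq_or_eq_neg.mp h with h | h
  · simp [h]
  · exact ⟨-z, by rw [h]; ring⟩

section Frobenius

variable {K : Type*} [Field K] [NumberField K]

theorem sq_dvd_of_sq_eq {p f : ℕ} (hp : p.Prime) (hf : f ≠ 0)
    {x : 𝓞 K} (h : (p : 𝓞 K) ∣ x ^ p ^ f - x) {d : ℤ} (hx : x ^ 2 = d)
    (hd : (p : ℤ) ∣ d) : (p : ℤ) ^ 2 ∣ d := by
  have h2 : 2 ≤ p ^ f := hp.two_le.trans (Nat.le_self_pow hf p)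
  have hpx : (p : 𝓞 K) ∣ x ^ 2 := by
    rw [hx]
    simpa using map_dvd (Int.castRingHom (𝓞 K)) hd
  have : (p : 𝓞 K) ∣ x := (dvd_sub_right (hpx.trans (pow_dvd_pow x h2))).mp h
  apply RingOfIntegers.int_dvd_of_dvd (K := K)
  push_cast
  rw [← hx]
  exact pow_dvd_pow_of_dvd this 2

theorem mod_four_eq_one_of_sq_eq {f : ℕ} (hf : f ≠ 0)
    {x : 𝓞 K} (h : (2 : 𝓞 K) ∣ x ^ 2 ^ f - x) {d : ℤ} (hx : x ^ 2 = d)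
    (hd : Odd d) : d % 4 = 1 := by
  obtain ⟨g, rfl⟩ := Nat.exists_eq_succ_of_ne_zero hf
  obtain ⟨e, he⟩ := (hd.pow (n := 2 ^ g))
  rw [pow_succ', pow_mul, hx, ← Int.cast_pow, he] at h
  obtain ⟨t, ht⟩ := h
  have : (4 : ℤ) ∣ d - 1 := by
    apply RingOfIntegers.int_dvd_of_dvd (K := K)
    push_cast at ht ⊢
    have hx' : x = 1 + 2 * (e - t) := by linear_combination -ht
    rw [← hx, hx']
    exact ⟨(e - t) + (e - t) ^ 2, by ring⟩
  omega

theorem even_of_sq_eq_two_mul {g : ℕ} {i x : K} (hi : i ^ 2 = -1) {d : ℤ}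
    (hx : x ^ 2 = 2 * d) (h : ∀ y : 𝓞 K, (2 : 𝓞 K) ∣ y ^ 2 ^ (g + 2) - y ^ 2) : Even d := by
  by_contra hd
  rw [Int.not_even_iff_odd] at hd
  have hi0 : 1 + i ≠ 0 := by
    intro h0
    rw [show i = -1 by linear_combination h0] at hi
    norm_num at hi
  have ht : (x / (1 + i)) ^ 2 = -i * d := by
    rw [div_pow, hx, div_eq_iff (pow_ne_zero 2 hi0)]
    linear_combination (i + 2) * (d : K) * hi
  have hiI : IsIntegral ℤ i := .of_pow two_pos (by rw [hi]; exact isIntegral_one.neg)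
  have htI : IsIntegral ℤ (x / (1 + i)) :=
    .of_pow two_pos (by rw [ht]; exact hiI.neg.mul (isIntegral_algebraMap (x := d)))
  obtain ⟨I, rfl⟩ : ∃ I : 𝓞 K, (I : K) = i := ⟨⟨i, hiI⟩, rfl⟩
  obtain ⟨T, hT⟩ : ∃ T : 𝓞 K, (T : K) = x / (1 + I) := ⟨⟨_, htI⟩, rfl⟩
  rw [← hT] at ht
  replace ht : T ^ 2 = -I * d := by
    apply RingOfIntegers.coe_injective
    simpa using ht
  replace hi : I ^ 2 = -1 := by
    apply RingOfIntegers.coe_injective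
    simpa using hi
  obtain ⟨e, he⟩ := (hd.pow (n := 2)).neg.pow (n := 2 ^ g)
  obtain ⟨c, hc⟩ := hd
  obtain ⟨u, hu⟩ := h T
  have hT4 : T ^ 2 ^ (g + 2) = 2 * e + 1 := by
    rw [pow_add, mul_comm, pow_mul, show T ^ 2 ^ 2 = ((-d ^ 2 : ℤ) : 𝓞 K) by
      push_cast
      linear_combination (T ^ 2 - I * d) * ht + (d : 𝓞 K) ^ 2 * hi, ← Int.cast_pow, he]
    push_cast
    rfl
  rw [hT4, ht, hc] at hu
  push_cast at hu
  have hv : 1 + I = 2 * (u - e - I * c) := by linear_combination hu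
  have hI : I = 2 * (u - e - I * c) ^ 2 := by
    apply mul_left_cancel₀ (two_ne_zero (α := 𝓞 K))
    linear_combination (1 + I + 2 * (u - e - I * c)) * hv - hi
  have : (2 : ℤ) ∣ -1 := by
    apply RingOfIntegers.int_dvd_of_dvd (K := K)
    push_cast
    rw [← hi]
    exact (Dvd.intro _ hI.symm).trans (dvd_pow_self I two_ne_zero)
  omega

end Frobenius

/-- A field with a primitive `n`-th root of unity contains `√±m` for each odd `m ∣ n`, with the
sign making the radicand `1` modulo `4`. -/
theorem IsPrimitiveRoot.exists_sq_eq_of_odd_dvd {K : Type*} [Field K] [CharZero K] {n : ℕ}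
    (hn : n ≠ 0) {ζ : K} (hζ : IsPrimitiveRoot ζ n) {m : ℕ} (hm : Odd m) (hmn : m ∣ n) :
    ∃ (x : K) (e : ℤ), x ^ 2 = e ∧ e.natAbs = m ∧ e % 4 = 1 := by
  induction m using Nat.recOnMul with
  | zero => simp at hm
  | one => exact ⟨1, 1, by simp⟩
  | mul a b iha ihb =>
    rw [Nat.odd_mul] at hm
    obtain ⟨x, e, h1, h2, h3⟩ := iha hm.1 ((dvd_mul_right _ _).trans hmn)
    obtain ⟨y, g, h4, h5, h6⟩ := ihb hm.2 ((dvd_mul_left _ _).trans hmn)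
    refine ⟨x * y, e * g, by rw [mul_pow, h1, h4]; push_cast; rfl, by rw [Int.natAbs_mul, h2, h5],
      by rw [Int.mul_emod, h3, h6]; rfl⟩
  | prime p hp =>
    have := Fact.mk hp
    obtain ⟨c, hc⟩ := hmn
    have hζp : IsPrimitiveRoot (ζ ^ c) p := hζ.pow (Nat.pos_of_ne_zero hn) (by rw [hc, mul_comm])
    have hp2 : ringChar (ZMod p) ≠ 2 := by
      rw [ZMod.ringChar_zmod_n]
      rintro rfl
      revert hm
      decide
    have hχ : (quadraticChar (ZMod p)).ringHomComp (Int.castRingHom K) ≠ 1 := by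
      rw [Ne, MulChar.ringHomComp_eq_one_iff (Int.castRingHom K).injective_int]
      exact quadraticChar_ne_one hp2
    have key := gaussSum_sq hχ ((quadraticChar_isQuadratic _).comp _)
      (AddChar.zmodChar_primitive_of_primitive_root p hζp)
    rw [MulChar.ringHomComp_apply, quadraticChar_neg_one hp2, ZMod.card] at key
    refine ⟨_, ZMod.χ₄ p * p, by rw [key]; push_cast; rfl, ?_⟩
    rcases (by rw [Nat.odd_iff] at hm; omega : p % 4 = 1 ∨ p % 4 = 3) with h | h
    · rw [ZMod.χ₄_nat_one_mod_four h]
      omega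
    · rw [ZMod.χ₄_nat_three_mod_four h]
      omega

theorem Squarefree.dvd_of_forall_prime_dvd {d : ℤ} (hd : Squarefree d) {n : ℕ}
    (h : ∀ p : ℕ, p.Prime → (p : ℤ) ∣ d → p ∣ n) : d ∣ n := by
  rw [← Int.natAbs_dvd_natAbs, Int.natAbs_natCast,
    ← Nat.prod_primeFactors_of_squarefree (Int.squarefree_natAbs.mpr hd)]
  refine Finset.prod_primes_dvd _ (fun p hp => (Nat.prime_of_mem_primeFactors hp).prime)
    fun p hp => h p (Nat.prime_of_mem_primeFactors hp) ?_
  exact Int.natCast_dvd.mpr (Nat.dvd_of_mem_primeFactors hp)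

section Cyclotomic

variable {K : Type*} [Field K] {n : ℕ} {ζ : K} {d : ℤ} {x : K}

theorem IsPrimitiveRoot.exists_sq_eq_of_discr_dvd [CharZero K] (hn : n ≠ 0)
    (hζ : IsPrimitiveRoot ζ n) (hd : Squarefree d)
    (h : (if d % 4 = 1 then d else 4 * d) ∣ (n : ℤ)) : ∃ x : K, x ^ 2 = d := by
  have primitive {m : ℕ} (hm : m ∣ n) : ∃ w : K, IsPrimitiveRoot w m := by
    obtain ⟨c, hc⟩ := hm
    exact ⟨ζ ^ c, hζ.pow (Nat.pos_of_ne_zero hn) (by rw [hc, mul_comm])⟩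
  have hd4 : ¬ (4 : ℤ) ∣ d := fun h4 => by
    have := Int.isUnit_iff.mp (hd 2 h4)
    omega
  have of_odd {b : ℤ} (hb : Odd b) (hbn : b ∣ n) (h4 : b % 4 = 1 ∨ 4 ∣ n) :
      ∃ x : K, x ^ 2 = b := by
    obtain ⟨x, e, hx, he, he4⟩ := hζ.exists_sq_eq_of_odd_dvd hn hb.natAbs
      (Int.natAbs_dvd_natAbs.mpr hbn)
    rcases Int.natAbs_eq_natAbs_iff.mp he with rfl | rfl
    · exact ⟨x, hx⟩
    · obtain ⟨i, hi⟩ := primitive (h4.resolve_left (by omega))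
      have hi2 : i ^ 2 = -1 := (hi.pow four_pos (by norm_num : 4 = 2 * 2)).eq_neg_one_of_two_right
      exact ⟨i * x, by rw [mul_pow, hi2, hx]; push_cast; ring⟩
  split_ifs at h with h1
  · exact of_odd (Int.odd_iff.mpr (by omega)) h (.inl h1)
  have h4 : 4 ∣ n := by exact_mod_cast (dvd_mul_right 4 d).trans h
  rcases Int.even_or_odd' d with ⟨b, rfl | rfl⟩
  · have h8 : 8 ∣ n := by exact_mod_cast (Dvd.intro b (by ring) : (8 : ℤ) ∣ 4 * (2 * b)).trans h
    obtain ⟨y, hy⟩ := of_odd (b := b) (Int.odd_iff.mpr (by omega))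
      ((Dvd.intro_left 8 (by ring)).trans h) (.inr h4)
    obtain ⟨w, hw⟩ := primitive h8
    have hw4 : w ^ 4 = -1 :=
      (hw.pow (by norm_num) (by norm_num : 8 = 4 * 2)).eq_neg_one_of_two_right
    refine ⟨(w - w ^ 3) * y, ?_⟩
    rw [mul_pow, hy]
    push_cast
    linear_combination (w ^ 2 - 2) * (b : K) * hw4
  · exact of_odd ⟨b, rfl⟩ ((Dvd.intro_left 4 rfl).trans h) (.inr h4)

theorem IsCyclotomicExtension.Rat.discr_dvd_of_sq_eq [NeZero n] [CharZero K]
    [IsCyclotomicExtension {n} ℚ K] (hζ : IsPrimitiveRoot ζ n) (hd : Squarefree d)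
    (hx : x ^ 2 = d) : (if d % 4 = 1 then d else 4 * d) ∣ (n : ℤ) := by
  have : NumberField K := IsCyclotomicExtension.numberField {n} ℚ K
  have hgen := IsCyclotomicExtension.Rat.adjoin_singleton_eq_top hζ
  have hz : hζ.toInteger ^ n = 1 := hζ.toInteger_isPrimitiveRoot.pow_eq_one
  obtain ⟨X, hX⟩ : ∃ X : 𝓞 K, (X : K) = x :=
    ⟨⟨x, .of_pow two_pos (by rw [hx]; exact isIntegral_algebraMap (x := d))⟩, rfl⟩
  have hX2 : X ^ 2 = d := by
    apply RingOfIntegers.coe_injective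
    simpa [hX] using hx
  have hsq {p : ℕ} (hp : p.Prime) : ¬ (p : ℤ) ^ 2 ∣ d := fun h => by
    have := Int.isUnit_iff.mp (hd p (by rwa [← sq]))
    have := hp.two_le
    omega
  have hprime (p : ℕ) (hp : p.Prime) (hpd : (p : ℤ) ∣ d) : p ∣ n := by
    by_contra hpn
    have := Fact.mk hp
    obtain ⟨f, hf, h⟩ := exists_pow_prime_pow_eq_self hp hpn hz
    refine hsq hp (sq_dvd_of_sq_eq hp hf (x := X) ?_ hX2 hpd)
    simpa using dvd_pow_sub_pow_of_adjoin_singleton (a := f) (b := 0) hgen (by simp [h]) X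
  have hdn : d ∣ n := hd.dvd_of_forall_prime_dvd hprime
  split_ifs with h1
  · exact hdn
  have h4 : 4 ∣ n := by
    by_contra h4
    obtain ⟨f, hf, h⟩ := exists_two_dvd_pow_two_pow_sub_self h4 hz
    have hX' : (2 : 𝓞 K) ∣ X ^ 2 ^ f - X := by
      simpa using dvd_pow_sub_pow_of_adjoin_singleton (p := 2) (b := 0) hgen (by simpa using h) X
    rcases Int.even_or_odd d with he | ho
    · exact hsq Nat.prime_two
        (sq_dvd_of_sq_eq Nat.prime_two hf (by simpa using hX') hX2 he.two_dvd)
    · exact h1 (mod_four_eq_one_of_sq_eq hf hX' hX2 ho)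
  rcases Int.even_or_odd' d with ⟨b, rfl | rfl⟩
  · have hb : ¬ Even b := fun ⟨c, hc⟩ => hsq Nat.prime_two ⟨c, by rw [hc]; push_cast; ring⟩
    have h8 : 8 ∣ n := by
      by_contra h8
      obtain ⟨c, rfl⟩ := h4
      obtain ⟨f, hf, h⟩ := exists_two_dvd_pow_two_pow_sub_self (n := 2 * c) (by omega)
        (z := hζ.toInteger ^ 2) (by rw [← pow_mul, ← hz]; ring)
      obtain ⟨g, rfl⟩ := Nat.exists_eq_succ_of_ne_zero hf
      rw [← pow_mul, ← pow_succ'] at h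
      have hc : c ≠ 0 := by rintro rfl; simp at h8
      refine hb (even_of_sq_eq_two_mul (g := g) (i := ζ ^ c) (x := x) ?_ (by simpa using hx) ?_)
      · exact ((hζ.pow (by omega) (mul_comm 4 c)).pow four_pos
          (by norm_num : 4 = 2 * 2)).eq_neg_one_of_two_right
      · intro y
        simpa using dvd_pow_sub_pow_of_adjoin_singleton (p := 2) (b := 1) hgen (by simpa using h) y
    rw [← mul_assoc]
    refine IsCoprime.mul_dvd ?_ (by omega) ((Dvd.intro_left 2 rfl).trans hdn)
    rw [show (4 * 2 : ℤ) = 2 ^ 3 by norm_num]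
    exact (Int.isCoprime_two_left.mpr (Int.not_even_iff_odd.mp hb)).pow_left
  · refine IsCoprime.mul_dvd ?_ (by omega) hdn
    rw [show (4 : ℤ) = 2 ^ 2 by norm_num]
    exact (Int.isCoprime_two_left.mpr ⟨b, rfl⟩).pow_left

end Cyclotomic

/-- For a positive integer `n` and a nonsquare integer `m`, `√m ∈ ℚ(ζ_n)` if and only if the
discriminant of the quadratic field `ℚ(√m)` divides `n`.  Here `m = d * k²` with `d` squarefree,
and the discriminant is `d` if `d ≡ 1 (mod 4)` and `4d` otherwise. -/
theorem sqrt_mem_cyclotomic_iff_discr_dvd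
    (n : ℕ) (hn : 0 < n) (m : ℤ) (hm : ¬ IsSquare m)
    (d k : ℤ) (hd : Squarefree d) (hk : k ≠ 0) (hmd : m = d * k ^ 2)
    (D : ℤ) (hD : D = if d % 4 = 1 then d else 4 * d)
    (ζ : ℂ) (hζ : IsPrimitiveRoot ζ n)
    (s : ℂ) (hs : s ^ 2 = (m : ℂ)) :
    s ∈ IntermediateField.adjoin ℚ {ζ} ↔ D ∣ (n : ℤ) := by
  have := NeZero.of_pos hn
  have hζ' : IsPrimitiveRoot (IntermediateField.AdjoinSimple.gen ℚ ζ) n :=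
    IsPrimitiveRoot.coe_submonoidClass_iff.mp hζ
  have : IsCyclotomicExtension {n} ℚ (IntermediateField.adjoin ℚ {ζ}) := by
    change IsCyclotomicExtension {n} ℚ (IntermediateField.adjoin ℚ {ζ}).toSubalgebra
    rw [IntermediateField.adjoin_simple_toSubalgebra_of_isAlgebraic
      (hζ.isIntegral hn).tower_top.isAlgebraic]
    exact hζ.adjoin_isCyclotomicExtension ℚ
  have hk' : (k : ℂ) ≠ 0 := Int.cast_ne_zero.mpr hk
  rw [hmd] at hs
  push_cast at hs
  rw [hD]
  constructor
  · intro h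
    refine IsCyclotomicExtension.Rat.discr_dvd_of_sq_eq hζ' hd
      (x := (⟨s, h⟩ : IntermediateField.adjoin ℚ {ζ}) / (k : IntermediateField.adjoin ℚ {ζ})) ?_
    apply Subtype.val_injective
    push_cast
    rw [div_pow, hs, mul_div_cancel_right₀ _ (pow_ne_zero 2 hk')]
  · intro h
    obtain ⟨x, hx⟩ := hζ'.exists_sq_eq_of_discr_dvd hn.ne' hd h
    have hx' : (x : ℂ) ^ 2 = d := by simpa using congrArg Subtype.val hx
    have hxk : (x : ℂ) * k ∈ IntermediateField.adjoin ℚ {ζ} := mul_mem x.2 (intCast_mem _ k)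
    rw [← hx', ← mul_pow] at hs
    rcases sq_eq_sq_iff_eq_or_eq_neg.mp hs with rfl | rfl
    · exact hxk
    · exact neg_mem hxk
end

section
/- Let K be a quadratic field containing exactly two roots of unity, γ ∈ K with |Norm_{K/ℚ}(γ)| = 1, and n a positive integer with ν_2(n) ≥ 3. Then γ ∈ K(ζ_n)ⁿ if and only if γ = δ^{n/2} for some δ ∈ K that is a square in K(ζ_n). -/
open IntermediateField in
theorem algEquiv_apply_eq_self_of_mem_adjoin {F M : Type*} [Field F] [Field M] [Algebra F M]
    {S : Set M} {σ : M ≃ₐ[F] M} (h : ∀ y ∈ S, σ y = y) {x : M} (hx : x ∈ adjoin F S) :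
    σ x = x := by
  induction hx using adjoin_induction with
  | mem x hx => exact h x hx
  | algebraMap x => simp
  | add x y _ _ hx hy => simp [hx, hy]
  | inv x _ hx => simp [hx]
  | mul x y _ _ hx hy => simp [hx, hy]

/-- If `γ ∈ K` is an `n`-th power of an element of `K(ζ_n)` and every root of unity in `K` of order
dividing `n` has order dividing `w`, then `γ ^ w` is an `n`-th power in `K`. -/
theorem exists_pow_eq_of_pow_mem_abelian {F M : Type*} [Field F] [Field M] [Algebra F M]
    [IsGalois F M] (K : IntermediateField F M) {n w : ℕ} (hn : 0 < n) {ζ : M}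
    (hζ : IsPrimitiveRoot ζ n)
    (hw : ∀ d : ℕ, d ∣ n → ∀ u ∈ K, IsPrimitiveRoot u d → d ∣ w)
    {ε : M} (hε0 : ε ≠ 0)
    (hε : ∀ σ : M ≃ₐ[F] M, (∀ y ∈ K, σ y = y) → σ ζ = ζ → σ ε = ε) (hγ : ε ^ n ∈ K) :
    ∃ η ∈ K, (ε ^ n) ^ w = η ^ n := by
  have : NeZero n := ⟨hn.ne'⟩
  have hζ0 : ζ ≠ 0 := hζ.ne_zero hn.ne'
  have hfix : ∀ x : M, (∀ σ : M ≃ₐ[F] M, (∀ y ∈ K, σ y = y) → σ x = x) → x ∈ K := by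
    intro x hx
    rw [← InfiniteGalois.fixedField_fixingSubgroup K, IntermediateField.mem_fixedField_iff]
    intro σ hσ
    exact hx σ ((IntermediateField.mem_fixingSubgroup_iff _ _).1 hσ)
  have hζσ : ∀ σ : M ≃ₐ[F] M, ∃ t : ℕ, σ ζ = ζ ^ t := by
    intro σ
    obtain ⟨t, -, ht⟩ := hζ.eq_pow_of_pow_eq_one (ξ := σ ζ) (by rw [← map_pow, hζ.pow_eq_one, map_one])
    exact ⟨t, ht.symm⟩
  have hεσ : ∀ σ : M ≃ₐ[F] M, (∀ y ∈ K, σ y = y) → ∃ c : ℕ, σ ε = ζ ^ c * ε := by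
    intro σ hσ
    obtain ⟨c, -, hc⟩ := hζ.eq_pow_of_pow_eq_one (ξ := σ ε / ε)
      (by rw [div_pow, ← map_pow, hσ _ hγ, div_self (pow_ne_zero _ hε0)])
    exact ⟨c, by rw [hc, div_mul_cancel₀ _ hε0]⟩
  let H : AddSubgroup ℤ :=
    { carrier := {m | ∃ η ∈ K, (ε ^ n) ^ m = η ^ n}
      zero_mem' := ⟨1, K.one_mem, by simp⟩
      add_mem' := by
        rintro a b ⟨x, hx, hx'⟩ ⟨y, hy, hy'⟩
        exact ⟨x * y, K.mul_mem hx hy, by rw [zpow_add₀ (pow_ne_zero _ hε0), hx', hy', mul_pow]⟩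
      neg_mem' := by
        rintro a ⟨x, hx, hx'⟩
        exact ⟨x⁻¹, K.inv_mem hx, by rw [zpow_neg, hx', inv_pow]⟩ }
  have hnH : (n : ℤ) ∈ H := ⟨ε ^ n, hγ, by simp⟩
  have htH : ∀ σ : M ≃ₐ[F] M, (∀ y ∈ K, σ y = y) → ∀ t : ℕ, σ ζ = ζ ^ t → (1 - t : ℤ) ∈ H := by
    intro σ hσ t ht
    refine ⟨σ ε / ε ^ t, hfix _ fun τ hτ ↦ ?_, ?_⟩
    · obtain ⟨c, hc⟩ := hεσ τ hτ
      obtain ⟨r, hr⟩ := hζσ τ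
      have hcomm : τ (σ ε) = σ (τ ε) := by
        have h1 : ((σ * τ)⁻¹ * (τ * σ)) ε = ε := by
          apply hε
          · intro y hy
            have : (σ * τ) y = y := by simp [hσ y hy, hτ y hy]
            rw [AlgEquiv.mul_apply, AlgEquiv.mul_apply, hσ y hy, hτ y hy]
            nth_rw 1 [← this]
            simp [← AlgEquiv.mul_apply, ← mul_assoc]
          · have : τ (σ ζ) = σ (τ ζ) := by
              rw [ht, hr, map_pow, map_pow, ht, hr, ← pow_mul, ← pow_mul, mul_comm]
            rw [AlgEquiv.mul_apply, AlgEquiv.mul_apply, this, ← AlgEquiv.mul_apply σ τ,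
              ← AlgEquiv.mul_apply, inv_mul_cancel, AlgEquiv.one_apply]
        have h2 := congrArg (σ * τ) h1
        rwa [← AlgEquiv.mul_apply, ← mul_assoc, mul_inv_cancel, one_mul] at h2
      rw [map_div₀, map_pow, hcomm, hc, map_mul, map_pow, ht, mul_pow, ← pow_mul, ← pow_mul,
        mul_comm t c, mul_div_mul_left _ _ (pow_ne_zero _ hζ0)]
    · rw [div_pow, ← map_pow, hσ _ hγ, zpow_sub₀ (pow_ne_zero _ hε0), zpow_one, zpow_natCast,
        ← pow_mul, ← pow_mul, mul_comm n t]
  suffices (w : ℤ) ∈ H by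
    obtain ⟨η, h1, h2⟩ := this
    exact ⟨η, h1, by simpa using h2⟩
  obtain ⟨d, hd⟩ := Int.subgroup_cyclic H
  have hmem : ∀ m : ℤ, m ∈ H ↔ ((d.natAbs : ℕ) : ℤ) ∣ m := by
    intro m
    rw [hd, ← AddSubgroup.zmultiples_eq_closure, Int.mem_zmultiples_iff, Int.natAbs_dvd]
  rw [hmem] at hnH ⊢
  rw [Int.natCast_dvd_natCast] at hnH ⊢
  obtain ⟨e, he⟩ := hnH
  refine hw _ ⟨e, he⟩ (ζ ^ e) (hfix _ fun σ hσ ↦ ?_)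
    (hζ.pow hn (by rw [he, mul_comm]))
  obtain ⟨t, ht⟩ := hζσ σ
  obtain ⟨k, hk⟩ := (hmem _).1 (htH σ hσ t ht)
  have h3 : ζ ^ ((e : ℤ) * (1 - t)) = 1 := by
    rw [hζ.zpow_eq_one_iff_dvd]
    refine ⟨k, ?_⟩
    have he' : (n : ℤ) = d.natAbs * e := by exact_mod_cast he
    rw [hk, he']
    ring
  rw [map_pow, ht, ← pow_mul]
  rw [mul_sub, mul_one, zpow_sub₀ hζ0, div_eq_one_iff_eq (zpow_ne_zero _ hζ0)] at h3
  rw [mul_comm]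
  exact_mod_cast h3.symm

theorem ratCast_sq_ne_intCast {Δ : ℤ} (hΔ : ¬ IsSquare Δ) (r : ℚ) : r ^ 2 ≠ Δ := by
  intro h
  exact hΔ (Rat.isSquare_intCast_iff.1 ⟨r, by rw [← h, sq]⟩)

open IntermediateField in
theorem exists_eq_add_mul_of_mem_adjoin_sqrt {M : Type*} [Field M] [Algebra ℚ M] {s : M} {Δ : ℤ}
    (hs : s ^ 2 = Δ) {x : M} (hx : x ∈ ℚ⟮s⟯) :
    ∃ p q : ℚ, x = algebraMap ℚ M p + algebraMap ℚ M q * s := by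
  have halg : IsAlgebraic ℚ s := by
    refine (IsIntegral.of_pow (n := 2) two_pos ?_).isAlgebraic
    rw [hs, ← map_intCast (algebraMap ℚ M)]
    exact isIntegral_algebraMap
  rw [← mem_toSubalgebra, adjoin_simple_toSubalgebra_of_isAlgebraic halg] at hx
  induction hx using Algebra.adjoin_induction with
  | mem x hx => exact ⟨0, 1, by simpa using hx⟩
  | algebraMap r => exact ⟨r, 0, by simp⟩
  | add x y _ _ hx hy =>
    obtain ⟨p, q, rfl⟩ := hx
    obtain ⟨p', q', rfl⟩ := hy
    exact ⟨p + p', q + q', by simp only [map_add]; ring⟩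
  | mul x y _ _ hx hy =>
    obtain ⟨p, q, rfl⟩ := hx
    obtain ⟨p', q', rfl⟩ := hy
    refine ⟨p * p' + q * q' * Δ, p * q' + q * p', ?_⟩
    simp only [map_add, map_mul, map_intCast]
    linear_combination (algebraMap ℚ M q) * (algebraMap ℚ M q') * hs

/-- `1` and `√Δ` are linearly independent over `ℚ`. -/
theorem algebraMap_add_mul_sqrt_eq_zero {M : Type*} [Field M] [Algebra ℚ M] {s : M} {Δ : ℤ}
    (hΔ : ¬ IsSquare Δ) (hs : s ^ 2 = Δ) {p q : ℚ}
    (h : algebraMap ℚ M p + algebraMap ℚ M q * s = 0) : p = 0 ∧ q = 0 := by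
  have h1 : algebraMap ℚ M (p ^ 2) = algebraMap ℚ M (q ^ 2 * Δ) := by
    simp only [map_pow, map_mul, map_intCast]
    linear_combination (algebraMap ℚ M p - algebraMap ℚ M q * s) * h + (algebraMap ℚ M q) ^ 2 * hs
  have h2 := (algebraMap ℚ M).injective h1
  by_cases hq : q = 0
  · subst hq
    simpa using h2
  · refine absurd ?_ (ratCast_sq_ne_intCast hΔ (p / q))
    field_simp
    linarith

/-- A rational integer that is the square of an element of `ℚ(√Δ)` is a square or `Δ` times a
square in `ℚ`. -/
theorem sq_eq_or_of_sq_eq_intCast {M : Type*} [Field M] [Algebra ℚ M] {s : M} {Δ m : ℤ}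
    (hΔ : ¬ IsSquare Δ) (hs : s ^ 2 = Δ) {x : M} (hx : x ∈ IntermediateField.adjoin ℚ {s})
    (hm : x ^ 2 = m) : (∃ p : ℚ, p ^ 2 = m) ∨ ∃ q : ℚ, q ^ 2 * Δ = m := by
  obtain ⟨p, q, rfl⟩ := exists_eq_add_mul_of_mem_adjoin_sqrt hs hx
  have h : algebraMap ℚ M (p ^ 2 + q ^ 2 * Δ - m) + algebraMap ℚ M (2 * p * q) * s = 0 := by
    simp only [map_add, map_sub, map_pow, map_mul, map_intCast, map_ofNat]
    linear_combination hm - (algebraMap ℚ M q) ^ 2 * hs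
  obtain ⟨h1, h2⟩ := algebraMap_add_mul_sqrt_eq_zero hΔ hs h
  have h3 : p = 0 ∨ q = 0 := by simpa using h2
  rcases h3 with rfl | rfl
  · exact Or.inr ⟨q, by linarith⟩
  · exact Or.inl ⟨p, by linarith⟩

theorem sq_mul_fundamental_ne_neg_one {Δ : ℤ} (hΔ4 : Δ ≠ -4)
    (hΔfund : (Δ % 4 = 1 ∧ Squarefree Δ) ∨
      ∃ d : ℤ, Δ = 4 * d ∧ Squarefree d ∧ (d % 4 = 2 ∨ d % 4 = 3)) (q : ℚ) :
    q ^ 2 * Δ ≠ -1 := by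
  intro h
  have hq : q ≠ 0 := by rintro rfl; simp at h
  have hsq : IsSquare (-Δ) := by
    refine Rat.isSquare_intCast_iff.1 ⟨q⁻¹, ?_⟩
    push_cast
    field_simp
    linarith
  obtain ⟨k, hk⟩ := hsq
  rcases hΔfund with ⟨h1, h2⟩ | ⟨d, rfl, h2, h3⟩
  · have := Int.isUnit_iff.1 (h2 k ⟨-1, by linarith⟩)
    rcases this with rfl | rfl <;> omega
  · have h2k : (2 : ℤ) ∣ k := by
      refine Int.prime_two.dvd_of_dvd_pow (n := 2) ⟨-2 * d, by linarith⟩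
    obtain ⟨j, rfl⟩ := h2k
    have := Int.isUnit_iff.1 (h2 j ⟨-1, by linarith⟩)
    rcases this with rfl | rfl <;> omega

theorem sq_mul_fundamental_ne_neg_three {Δ : ℤ} (hΔ3 : Δ ≠ -3)
    (hΔfund : (Δ % 4 = 1 ∧ Squarefree Δ) ∨
      ∃ d : ℤ, Δ = 4 * d ∧ Squarefree d ∧ (d % 4 = 2 ∨ d % 4 = 3)) (q : ℚ) :
    q ^ 2 * Δ ≠ -3 := by
  intro h
  have hq : q ≠ 0 := by rintro rfl; simp at h
  have hsq : IsSquare (-3 * Δ) := by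
    refine Rat.isSquare_intCast_iff.1 ⟨3 * q⁻¹, ?_⟩
    push_cast
    field_simp
    linarith
  obtain ⟨k, hk⟩ := hsq
  have h3k : (3 : ℤ) ∣ k :=
    Int.prime_three.dvd_of_dvd_pow (n := 2) ⟨-Δ, by linarith⟩
  obtain ⟨j, rfl⟩ := h3k
  have hj : Δ = -3 * (j * j) := by linarith
  rcases hΔfund with ⟨h1, h2⟩ | ⟨d, rfl, h2, h3⟩
  · have := Int.isUnit_iff.1 (h2 j ⟨-3, by linarith⟩)
    rcases this with rfl | rfl <;> omega
  · have h2j : (2 : ℤ) ∣ j := by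
      have : (2 : ℤ) ∣ j * j := by omega
      rcases Int.prime_two.dvd_or_dvd this with h | h <;> exact h
    obtain ⟨i, rfl⟩ := h2j
    have := Int.isUnit_iff.1 (h2 i ⟨-3, by linarith⟩)
    rcases this with rfl | rfl <;> omega

open Polynomial in
theorem totient_le_two_of_mem_adjoin_sqrt {M : Type*} [Field M] [Algebra ℚ M] [CharZero M] {s : M}
    {Δ : ℤ} (hs : s ^ 2 = Δ) {d : ℕ} (hd : 0 < d) {u : M}
    (hu : u ∈ IntermediateField.adjoin ℚ {s}) (hud : IsPrimitiveRoot u d) : d.totient ≤ 2 := by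
  obtain ⟨p, q, hpq⟩ := exists_eq_add_mul_of_mem_adjoin_sqrt hs hu
  have hmonic : (X ^ 2 + (C (-2 * p) * X + C (p ^ 2 - q ^ 2 * Δ)) : ℚ[X]).Monic := by
    monicity!
  have hroot : aeval u (X ^ 2 + (C (-2 * p) * X + C (p ^ 2 - q ^ 2 * Δ)) : ℚ[X]) = 0 := by
    simp only [map_add, map_mul, map_pow, aeval_X, aeval_C, map_sub, map_neg, map_ofNat,
      map_intCast]
    rw [hpq]
    linear_combination (algebraMap ℚ M q) ^ 2 * hs
  have h1 := minpoly.min ℚ u hmonic hroot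
  have : NeZero (d : ℚ) := ⟨by exact_mod_cast hd.ne'⟩
  rw [← hud.minpoly_eq_cyclotomic_of_irreducible (cyclotomic.irreducible_rat hd),
    degree_cyclotomic] at h1
  have h2 : (X ^ 2 + (C (-2 * p) * X + C (p ^ 2 - q ^ 2 * Δ)) : ℚ[X]).degree ≤ 2 := by
    compute_degree
  exact_mod_cast h1.trans h2

/-- A quadratic field of fundamental discriminant `Δ ≠ -3, -4` contains only the roots of unity
`± 1`. -/
theorem dvd_two_of_isPrimitiveRoot_mem_adjoin_sqrt {M : Type*} [Field M] [Algebra ℚ M]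
    [CharZero M] {s : M} {Δ : ℤ} (hΔns : ¬ IsSquare Δ) (hΔ3 : Δ ≠ -3) (hΔ4 : Δ ≠ -4)
    (hΔfund : (Δ % 4 = 1 ∧ Squarefree Δ) ∨
      ∃ d : ℤ, Δ = 4 * d ∧ Squarefree d ∧ (d % 4 = 2 ∨ d % 4 = 3))
    (hs : s ^ 2 = Δ) {d : ℕ} (hd : 0 < d) {u : M}
    (hu : u ∈ IntermediateField.adjoin ℚ {s}) (hud : IsPrimitiveRoot u d) : d ∣ 2 := by
  have h4 : ¬ 4 ∣ d := by
    rintro ⟨e, he⟩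
    have h := hud.pow hd (he.trans (mul_comm 4 e))
    have h' : (u ^ e) ^ 2 = ((-1 : ℤ) : M) := by
      have := (h.pow (by norm_num) (show 4 = 2 * 2 by norm_num)).eq_neg_one_of_two_right
      simpa using this
    rcases sq_eq_or_of_sq_eq_intCast hΔns hs (pow_mem hu e) h' with ⟨p, hp⟩ | ⟨q, hq⟩
    · push_cast at hp
      nlinarith [sq_nonneg p]
    · exact sq_mul_fundamental_ne_neg_one hΔ4 hΔfund q (by simpa using hq)
  have hprime : ∀ p : ℕ, p.Prime → p ∣ d → p = 2 := by
    rintro p hp ⟨e, he⟩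
    have h := hud.pow hd (he.trans (mul_comm p e))
    have h1 := totient_le_two_of_mem_adjoin_sqrt hs hp.pos (pow_mem hu e) h
    rw [Nat.totient_prime hp] at h1
    have h2 := hp.two_le
    by_contra hne
    obtain rfl : p = 3 := by omega
    have h' : (2 * u ^ e + 1) ^ 2 = ((-3 : ℤ) : M) := by
      have h5 : (u ^ e) ^ 2 + u ^ e + 1 = 0 := by
        have h6 : (u ^ e - 1) * ((u ^ e) ^ 2 + u ^ e + 1) = 0 := by
          linear_combination h.pow_eq_one
        exact (mul_eq_zero.1 h6).resolve_left (sub_ne_zero.2 (h.ne_one (by norm_num)))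
      push_cast
      linear_combination 4 * h5
    have hmem : 2 * u ^ e + 1 ∈ IntermediateField.adjoin ℚ {s} :=
      add_mem (mul_mem (ofNat_mem _ 2) (pow_mem hu e)) (one_mem _)
    rcases sq_eq_or_of_sq_eq_intCast hΔns hs hmem h' with ⟨p, hp⟩ | ⟨q, hq⟩
    · push_cast at hp
      nlinarith [sq_nonneg p]
    · exact sq_mul_fundamental_ne_neg_three hΔ3 hΔfund q (by simpa using hq)
  obtain ⟨k, hk⟩ : ∃ k, d = 2 ^ k :=
    ⟨_, Nat.eq_prime_pow_of_unique_prime_dvd hd.ne' fun {p} hp hpd ↦ hprime p hp hpd⟩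
  have hk1 : k ≤ 1 := by
    by_contra! hk2
    exact h4 (hk ▸ pow_dvd_pow 2 hk2)
  rw [hk]
  exact pow_dvd_pow 2 hk1

/-- If `8 ∣ n`, then `x ^ 2 = η ∈ ℚ(√Δ)` with `η` of norm `± 1` implies that `x` times a primitive
`2n`-th root of unity does not lie in `ℚ(√Δ, ζ_n)`. -/
theorem mul_notMem_adjoin_of_sq_mem {M : Type*} [Field M] [Algebra ℚ M] [CharZero M]
    [IsGalois ℚ M] {s : M} {Δ : ℤ} (hs : s ^ 2 = Δ) {n : ℕ} (hn : 0 < n) (h8 : 8 ∣ n) {ω : M}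
    (hω : IsPrimitiveRoot ω (2 * n)) {p q : ℚ}
    (hN : p ^ 2 - q ^ 2 * Δ = 1 ∨ p ^ 2 - q ^ 2 * Δ = -1) {x : M}
    (hx : x ^ 2 = algebraMap ℚ M p + algebraMap ℚ M q * s) :
    ω * x ∉ IntermediateField.adjoin ℚ {s, ω ^ 2} := by
  intro hmem
  obtain ⟨m, rfl⟩ := h8
  have hω0 : ω ≠ 0 := hω.ne_zero (by omega)
  have hcop : (1 + 4 * m).Coprime (2 * (8 * m)) := by
    refine Nat.Coprime.mul_right (by simp [Nat.coprime_two_right]; exact ⟨2 * m, by ring⟩) ?_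
    refine Nat.Coprime.mul_right ?_ (by simp)
    rw [show 8 = 2 ^ 3 by norm_num]
    exact Nat.Coprime.pow_right 3 (by simp [Nat.coprime_two_right]; exact ⟨2 * m, by ring⟩)
  obtain ⟨g, hg⟩ : ∃ g : M ≃ₐ[ℚ] M, g ω = ω ^ (1 + 4 * m) := by
    have : NeZero ((2 * (8 * m) : ℕ) : ℚ) := ⟨by exact_mod_cast (by omega : 2 * (8 * m) ≠ 0)⟩
    have hirr := Polynomial.cyclotomic.irreducible_rat (n := 2 * (8 * m)) (by omega)
    rw [← isConjRoot_iff_exists_algEquiv, isConjRoot_def,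
      ← hω.minpoly_eq_cyclotomic_of_irreducible hirr,
      ← (hω.pow_of_coprime _ hcop).minpoly_eq_cyclotomic_of_irreducible hirr]
  have hpow : ω ^ (8 * m) = -1 :=
    (hω.pow (by omega) (by ring : 2 * (8 * m) = (8 * m) * 2)).eq_neg_one_of_two_right
  have hi : (ω ^ (4 * m)) ^ 2 = -1 := by rw [← pow_mul, ← hpow]; ring_nf
  have hgi : g (ω ^ (4 * m)) = ω ^ (4 * m) := by
    rw [map_pow, hg, ← pow_mul, show (1 + 4 * m) * (4 * m) = 4 * m + (8 * m) * (2 * m) by ring,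
      pow_add, pow_mul ω (8 * m), hpow, pow_mul]
    simp
  have hggω : g (g ω) = -ω := by
    rw [hg, pow_add, map_mul, pow_one, hgi, hg]
    linear_combination (norm := ring_nf) ω * hi
  have hgs : g s = s ∨ g s = -s := by
    rw [← sq_eq_sq_iff_eq_or_eq_neg, ← map_pow, hs, map_intCast]
  have hggs : g (g s) = s := by
    rcases hgs with h | h <;> simp [h]
  have hx0 : x ≠ 0 := by
    rintro rfl
    have h : algebraMap ℚ M (p ^ 2 - q ^ 2 * Δ) = 0 := by
      simp only [map_sub, map_mul, map_pow, map_intCast]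
      linear_combination -(algebraMap ℚ M p - algebraMap ℚ M q * s) * hx +
        (algebraMap ℚ M q) ^ 2 * hs
    rw [map_eq_zero] at h
    rcases hN with hN | hN <;> simp [h] at hN
  have hgx2 : (g x) ^ 2 = algebraMap ℚ M p + algebraMap ℚ M q * g s := by
    rw [← map_pow, hx]; simp
  have hggx : g (g x) = x := by
    rcases hgs with h | h
    · have : g x = x ∨ g x = -x := by rw [← sq_eq_sq_iff_eq_or_eq_neg, hgx2, hx, h]
      rcases this with h | h <;> simp [h]
    · have hprod : (x * g x) ^ 2 = algebraMap ℚ M (p ^ 2 - q ^ 2 * Δ) := by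
        rw [mul_pow, hgx2, hx, h]
        simp only [map_sub, map_mul, map_pow, map_intCast]
        linear_combination -(algebraMap ℚ M q) ^ 2 * hs
      have hfix : g (x * g x) = x * g x := by
        rcases hN with hN | hN
        · rw [hN, map_one, ← one_pow 2, sq_eq_sq_iff_eq_or_eq_neg] at hprod
          rcases hprod with h | h <;> simp only [h, map_neg, map_one]
        · rw [hN, map_neg, map_one, ← hi, sq_eq_sq_iff_eq_or_eq_neg] at hprod
          rcases hprod with h | h <;> simp only [h, map_neg, hgi]
      rw [map_mul, mul_comm] at hfix
      exact mul_right_cancel₀ (by simpa using hx0) hfix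
  have hfin : (g * g) (ω * x) = ω * x := by
    refine algEquiv_apply_eq_self_of_mem_adjoin ?_ hmem
    rintro y (rfl | rfl)
    · simpa using hggs
    · simp [hggω]
  rw [AlgEquiv.mul_apply, map_mul, map_mul, hggω, hggx, neg_mul, neg_eq_self] at hfin
  exact mul_ne_zero hω0 hx0 hfin

theorem add_mul_sqrt_pow {M : Type*} [Field M] [Algebra ℚ M] {s : M} {Δ : ℤ} (hs : s ^ 2 = Δ)
    (p q : ℚ) (k : ℕ) : ∃ P Q : ℚ,
      (algebraMap ℚ M p + algebraMap ℚ M q * s) ^ k = algebraMap ℚ M P + algebraMap ℚ M Q * s ∧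
      P ^ 2 - Q ^ 2 * Δ = (p ^ 2 - q ^ 2 * Δ) ^ k := by
  induction k with
  | zero => exact ⟨1, 0, by simp, by simp⟩
  | succ k ih =>
    obtain ⟨P, Q, h1, h2⟩ := ih
    refine ⟨P * p + Q * q * Δ, P * q + Q * p, ?_, ?_⟩
    · rw [pow_succ, h1]
      simp only [map_add, map_mul, map_intCast]
      linear_combination (algebraMap ℚ M Q) * (algebraMap ℚ M q) * hs
    · rw [pow_succ _ k, ← h2]
      ring

theorem exists_sq_and_pow_eq_of_mem_adjoin {M : Type*} [Field M] [Algebra ℚ M] [CharZero M]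
    [IsGalois ℚ M] {s : M} {Δ : ℤ} (hΔns : ¬ IsSquare Δ) (hΔ3 : Δ ≠ -3) (hΔ4 : Δ ≠ -4)
    (hΔfund : (Δ % 4 = 1 ∧ Squarefree Δ) ∨
      ∃ d : ℤ, Δ = 4 * d ∧ Squarefree d ∧ (d % 4 = 2 ∨ d % 4 = 3))
    (hs : s ^ 2 = Δ) {a b : ℚ} (hNorm : |a ^ 2 - b ^ 2 * (Δ : ℚ)| = 1)
    {n : ℕ} (hn : 0 < n) (h8 : 8 ∣ n) {ω : M} (hω : IsPrimitiveRoot ω (2 * n)) {ε : M}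
    (hε : ε ∈ IntermediateField.adjoin ℚ {s, ω ^ 2})
    (hγ : ε ^ n = algebraMap ℚ M a + algebraMap ℚ M b * s) :
    ∃ δ ∈ IntermediateField.adjoin ℚ {s},
      (∃ y ∈ IntermediateField.adjoin ℚ {s, ω ^ 2}, y ^ 2 = δ) ∧ δ ^ (n / 2) = ε ^ n := by
  have hζ : IsPrimitiveRoot (ω ^ 2) n := hω.pow (by omega) rfl
  have hω0 : ω ≠ 0 := hω.ne_zero (by omega)
  have hs_mem : s ∈ IntermediateField.adjoin ℚ {s} :=
    IntermediateField.mem_adjoin_simple_self ℚ s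
  have hζ_mem : ω ^ 2 ∈ IntermediateField.adjoin ℚ {s, ω ^ 2} :=
    IntermediateField.subset_adjoin ℚ _ (by simp)
  have hε0 : ε ≠ 0 := by
    rintro rfl
    rw [zero_pow hn.ne'] at hγ
    obtain ⟨rfl, rfl⟩ := algebraMap_add_mul_sqrt_eq_zero hΔns hs hγ.symm
    simp at hNorm
  have hγ_mem : ε ^ n ∈ IntermediateField.adjoin ℚ {s} := by
    rw [hγ]
    exact add_mem (algebraMap_mem _ _) (mul_mem (algebraMap_mem _ _) hs_mem)
  obtain ⟨η, hη, hηn⟩ := exists_pow_eq_of_pow_mem_abelian (w := 2)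
    (IntermediateField.adjoin ℚ {s}) hn hζ
    (fun d hd u hu hud ↦ dvd_two_of_isPrimitiveRoot_mem_adjoin_sqrt hΔns hΔ3 hΔ4 hΔfund hs
      (Nat.pos_of_dvd_of_pos hd hn) hu hud) hε0
    (fun σ hσ hσζ ↦ algEquiv_apply_eq_self_of_mem_adjoin
      (by rintro y (rfl | rfl); exacts [hσ _ hs_mem, hσζ]) hε) hγ_mem
  have hη0 : η ≠ 0 := by
    rintro rfl
    rw [zero_pow hn.ne'] at hηn
    exact pow_ne_zero _ (pow_ne_zero _ hε0) hηn
  obtain ⟨k, rfl⟩ : ∃ k, n = 2 * k := ⟨n / 2, by omega⟩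
  have hk : 0 < k := by omega
  have : NeZero k := ⟨hk.ne'⟩
  have hk2 : 2 * k / 2 = k := by omega
  have hζ2 : IsPrimitiveRoot ((ω ^ 2) ^ 2) k := hζ.pow hn rfl
  rw [mul_comm 2 k, pow_mul η, sq_eq_sq_iff_eq_or_eq_neg, mul_comm k 2] at hηn
  rcases hηn with h | h
  · refine ⟨η, hη, ?_, by rw [hk2, h]⟩
    obtain ⟨i, -, hi⟩ := hζ2.eq_pow_of_pow_eq_one (ξ := ε ^ 2 / η)
      (by rw [div_pow, ← pow_mul, h, div_self (pow_ne_zero _ hη0)])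
    refine ⟨ε / (ω ^ 2) ^ i, div_mem hε (pow_mem hζ_mem i), ?_⟩
    rw [div_pow, ← pow_mul, mul_comm i 2, pow_mul (ω ^ 2), hi]
    field_simp
  · exfalso
    have hωk : (ω ^ 2) ^ k = -1 := by
      rw [← pow_mul]
      exact (hω.pow (by omega) (mul_comm _ _)).eq_neg_one_of_two_right
    obtain ⟨i, -, hi⟩ := hζ2.eq_pow_of_pow_eq_one (ξ := ε ^ 2 / (ω ^ 2 * η))
      (by rw [div_pow, ← pow_mul, h, mul_pow, hωk, neg_one_mul,
        div_self (neg_ne_zero.2 (pow_ne_zero _ hη0))])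
    obtain ⟨p, q, hpq⟩ := exists_eq_add_mul_of_mem_adjoin_sqrt hs hη
    obtain ⟨P, Q, hPQ, hnorm⟩ := add_mul_sqrt_pow hs p q k
    have hzero : algebraMap ℚ M (P + a) + algebraMap ℚ M (Q + b) * s = 0 := by
      rw [h, hpq, hPQ] at hγ
      simp only [map_add]
      linear_combination -hγ
    obtain ⟨hP, hQ⟩ := algebraMap_add_mul_sqrt_eq_zero hΔns hs hzero
    obtain rfl : P = -a := by linarith
    obtain rfl : Q = -b := by linarith
    have hN : |p ^ 2 - q ^ 2 * (Δ : ℚ)| = 1 := by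
      rw [neg_sq, neg_sq] at hnorm
      rw [hnorm, abs_pow] at hNorm
      exact (pow_eq_one_iff_of_nonneg (abs_nonneg _) hk.ne').1 hNorm
    refine mul_notMem_adjoin_of_sq_mem hs hn h8 hω (p := p) (q := q)
      (x := ε / (ω * (ω ^ 2) ^ i)) ((abs_eq zero_le_one).1 hN) ?_ ?_
    · rw [← hpq, div_pow, mul_pow, ← pow_mul (ω ^ 2), mul_comm i 2, pow_mul (ω ^ 2), hi]
      field_simp
    · rw [← mul_div_assoc, mul_div_mul_left _ _ hω0]
      exact div_mem hε (pow_mem hζ_mem i)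


/-- Let `K = ℚ(√Δ)` be a quadratic field with fundamental discriminant `Δ ∉ {-3, -4}` (so `K`
contains exactly two roots of unity), let `γ = a + b√Δ ∈ K` with `|Norm(γ)| = 1`, and let `n`
be a positive integer with `ν₂(n) ≥ 3`. Then `γ ∈ K(ζ_n)ⁿ` iff `γ = δ^{n/2}` for some `δ ∈ K`
that is a square in `K(ζ_n)`. -/
theorem mem_nth_powers_iff_two_valuation_large
    (Δ : ℤ) (hΔns : ¬ IsSquare Δ) (hΔ3 : Δ ≠ -3) (hΔ4 : Δ ≠ -4)
    (hΔfund : (Δ % 4 = 1 ∧ Squarefree Δ) ∨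
      ∃ d : ℤ, Δ = 4 * d ∧ Squarefree d ∧ (d % 4 = 2 ∨ d % 4 = 3))
    (sΔ : ℂ) (hsΔ : sΔ ^ 2 = (Δ : ℂ))
    (a b : ℚ) (γ : ℂ) (hγ : γ = (a : ℂ) + (b : ℂ) * sΔ)
    (hNorm : |a ^ 2 - b ^ 2 * (Δ : ℚ)| = 1)
    (n : ℕ) (hn : 0 < n) (h2 : 3 ≤ padicValNat 2 n)
    (ζ : ℂ) (hζ : IsPrimitiveRoot ζ n) :
    (∃ ε ∈ IntermediateField.adjoin ℚ {sΔ, ζ}, ε ^ n = γ) ↔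
      ∃ δ ∈ IntermediateField.adjoin ℚ {sΔ},
        (∃ y ∈ IntermediateField.adjoin ℚ {sΔ, ζ}, y ^ 2 = δ) ∧ δ ^ (n / 2) = γ := by
  have h8 : 8 ∣ n := (pow_dvd_pow 2 h2).trans pow_padicValNat_dvd
  constructor
  · rintro ⟨ε, hε, hεγ⟩
    obtain ⟨ω, hω, rfl⟩ : ∃ ω : ℂ, IsPrimitiveRoot ω (2 * n) ∧ ω ^ 2 = ζ := by
      have hω := Complex.isPrimitiveRoot_exp (2 * n) (by omega)
      have : NeZero n := ⟨hn.ne'⟩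
      obtain ⟨i, -, hi, rfl⟩ := (hω.pow (by omega) rfl).isPrimitiveRoot_iff.1 hζ
      refine ⟨_, hω.pow_of_coprime i (Nat.Coprime.mul_right ?_ hi), by rw [pow_right_comm]⟩
      exact hi.coprime_dvd_right ((by norm_num : 2 ∣ 8).trans h8)
    let A := algebraicClosure ℚ ℂ
    have : IsAlgClosure ℚ A := algebraicClosure.isAlgClosure ℚ ℂ
    have : Normal ℚ A := IsAlgClosure.normal ℚ A
    have : IsGalois ℚ A := ⟨⟩
    have hsA : sΔ ∈ A := by
      refine mem_algebraicClosure_iff.2 (IsIntegral.of_pow (n := 2) two_pos ?_).isAlgebraic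
      rw [hsΔ, ← map_intCast (algebraMap ℚ ℂ)]
      exact isIntegral_algebraMap
    have hωA : ω ∈ A :=
      mem_algebraicClosure_iff.2 (hω.isIntegral (by omega)).tower_top.isAlgebraic
    have hmap : IntermediateField.map A.val
          (IntermediateField.adjoin ℚ {(⟨sΔ, hsA⟩ : A), (⟨ω, hωA⟩ : A) ^ 2}) =
        IntermediateField.adjoin ℚ {sΔ, ω ^ 2} := by
      rw [IntermediateField.adjoin_map, Set.image_pair]
      rfl
    have hmap' : IntermediateField.map A.val (IntermediateField.adjoin ℚ {(⟨sΔ, hsA⟩ : A)}) =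
        IntermediateField.adjoin ℚ {sΔ} := by
      rw [IntermediateField.adjoin_map, Set.image_singleton]
      rfl
    rw [← hmap] at hε
    obtain ⟨ε, hε, rfl⟩ := hε
    have hωprim : IsPrimitiveRoot (⟨ω, hωA⟩ : A) (2 * n) :=
      IsPrimitiveRoot.of_map_of_injective (f := A.val) hω A.val.injective
    obtain ⟨δ, hδ, ⟨y, hy, hyδ⟩, hδγ⟩ := exists_sq_and_pow_eq_of_mem_adjoin hΔns hΔ3 hΔ4 hΔfund
      (s := (⟨sΔ, hsA⟩ : A)) (Subtype.ext (by simpa using hsΔ)) hNorm hn h8 hωprim hε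
      (Subtype.ext (by simpa [hγ] using hεγ))
    refine ⟨A.val δ, hmap' ▸ ⟨δ, hδ, rfl⟩, ⟨A.val y, hmap ▸ ⟨y, hy, rfl⟩, ?_⟩, ?_⟩
    · rw [← map_pow, hyδ]
    · rw [← map_pow, hδγ, map_pow]
      exact hεγ
  · rintro ⟨δ, -, ⟨y, hy, rfl⟩, hδ⟩
    refine ⟨y, hy, ?_⟩
    rw [← hδ, ← pow_mul, Nat.mul_div_cancel' ((by norm_num : 2 ∣ 8).trans h8)]
end

section
/- For positive integers h, m, t with the Wagstaff sum defined as S_{h,m}(t) := ∑_{n ≥ 1, m ∣ nt} μ(n)·gcd(nt, h)/(φ(nt)·nt), the series converges absolutely and S_{h,m}(t) = A·B_h·F_h(t)·G_{h,m}(t), where A = ∏_p (1 − 1/(p(p−1))) is the Artin constant, B_h = 2·∏_{p > 2, p ∣ h}(1 − (p−1)/(p² − p − 1)), F_h(t) = (gcd(t,h)/(φ(t)·t))·∏_{p > 2, p ∣ t}(1 − gcd(pt,h)/(p²·gcd(t,h)))·(1 − gcd(p,h)/(p(p−1)))^{−1}, and G_{h,m}(t) = G̃_{h, m/gcd(m,t)}(t)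 with G̃_{h,M}(t) := |μ(M)|·∏_{p > 2, p ∣ M}(1 − 1/f_h(t,p))^{−1}·(1 − f_h(t,2)) if 2 ∤ M, and := |μ(M)|·∏_{p > 2, p ∣ M}(1 − 1/f_h(t,p))^{−1}·(−f_h(t,2)) if 2 ∣ M, where f_h(t,n) := gcd(nt,h)·φ(t)/(gcd(t,h)·φ(nt)·n). -/
open scoped BigOperators

/-- The Artin constant `A = ∏_p (1 - 1/(p(p-1)))`. -/
noncomputable def artinConstant : ℝ :=
  ∏' p : Nat.Primes, (1 - 1 / ((p : ℝ) * ((p : ℝ) - 1)))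

/-- `B_h = 2·∏_{p > 2, p ∣ h} (1 - (p-1)/(p² - p - 1))`. -/
noncomputable def wagstaffB (h : ℕ) : ℝ :=
  2 * ∏ p ∈ h.primeFactors.filter (fun p => 2 < p),
    (1 - ((p : ℝ) - 1) / ((p : ℝ) ^ 2 - (p : ℝ) - 1))

/-- `f_h(t,n) = gcd(nt,h)·φ(t) / (gcd(t,h)·φ(nt)·n)`. -/
noncomputable def wagstafff (h t n : ℕ) : ℝ :=
  (Nat.gcd (n * t) h * Nat.totient t : ℝ) / (Nat.gcd t h * Nat.totient (n * t) * n : ℝ)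

/-- `F_h(t) = (gcd(t,h)/(φ(t)·t)) · ∏_{p > 2, p ∣ t}
(1 - gcd(pt,h)/(p²·gcd(t,h)))·(1 - gcd(p,h)/(p(p-1)))⁻¹`. -/
noncomputable def wagstaffFfun (h t : ℕ) : ℝ :=
  (Nat.gcd t h : ℝ) / (Nat.totient t * t : ℝ) *
    ∏ p ∈ t.primeFactors.filter (fun p => 2 < p),
      (1 - (Nat.gcd (p * t) h : ℝ) / ((p : ℝ) ^ 2 * Nat.gcd t h)) *
        (1 - (Nat.gcd p h : ℝ) / ((p : ℝ) * ((p : ℝ) - 1)))⁻¹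

/-- `G̃_{h,M}(t)`. -/
noncomputable def wagstaffGtilde (h M t : ℕ) : ℝ :=
  |(ArithmeticFunction.moebius M : ℝ)| *
    (∏ p ∈ M.primeFactors.filter (fun p => 2 < p), (1 - 1 / wagstafff h t p)⁻¹) *
    (if 2 ∣ M then -(wagstafff h t 2) else 1 - wagstafff h t 2)

/-- `G_{h,m}(t) = G̃_{h, m/gcd(m,t)}(t)`. -/
noncomputable def wagstaffG (h m t : ℕ) : ℝ :=
  wagstaffGtilde h (m / Nat.gcd m t) t

/-- The `n`-th term of the Wagstaff sum `S_{h,m}(t)`. -/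
noncomputable def wagstaffTerm (h m t n : ℕ) : ℝ :=
  if m ∣ n * t then
    (ArithmeticFunction.moebius n : ℝ) * (Nat.gcd (n * t) h : ℝ) /
      (Nat.totient (n * t) * (n * t) : ℝ)
  else 0

open ArithmeticFunction

/-- The restriction of an arithmetic function to the integers coprime to `M`. -/
noncomputable def coprimeRestrict (g : ArithmeticFunction ℝ) (M : ℕ) : ArithmeticFunction ℝ :=
  ⟨fun n => if M.Coprime n then g n else 0, by simp⟩

theorem coprimeRestrict_apply (g : ArithmeticFunction ℝ) (M n : ℕ) :
    coprimeRestrict g M n = if M.Coprime n then g n else 0 := rfl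

theorem isMultiplicative_coprimeRestrict {g : ArithmeticFunction ℝ} (hg : g.IsMultiplicative)
    (M : ℕ) : (coprimeRestrict g M).IsMultiplicative := by
  refine ⟨by simp [coprimeRestrict_apply, hg.map_one], fun {a b} hab => ?_⟩
  simp only [coprimeRestrict_apply, Nat.coprime_mul_iff_right, hg.map_mul_of_coprime hab]
  split_ifs <;> simp_all

theorem summable_norm_coprimeRestrict {g : ArithmeticFunction ℝ} (hs : Summable fun n => ‖g n‖)
    (M : ℕ) : Summable fun n => ‖coprimeRestrict g M n‖ := by
  refine hs.of_nonneg_of_le (fun _ => norm_nonneg _) fun n => ?_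
  rw [coprimeRestrict_apply]
  split_ifs <;> simp

theorem hasProd_one_add_of_isMultiplicative {g : ArithmeticFunction ℝ} (hg : g.IsMultiplicative)
    (hs : Summable fun n => ‖g n‖) (hsq : ∀ n, ¬ Squarefree n → g n = 0) :
    HasProd (fun p : Nat.Primes => 1 + g p) (∑' n, g n) := by
  have hloc (p : Nat.Primes) : ∑' e, g (p ^ e) = 1 + g p := by
    rw [tsum_eq_sum (s := Finset.range 2), Finset.sum_range_succ, Finset.sum_range_one, pow_zero,
      pow_one, hg.map_one]
    intro e he
    refine hsq _ fun h => ?_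
    rw [Finset.mem_range, not_lt] at he
    exact p.2.not_isUnit (h p ((pow_two (p : ℕ)) ▸ pow_dvd_pow _ he))
  have h := hg.eulerProduct_hasProd hs
  simp only [hloc] at h
  exact h

theorem tsum_multiples_eq {g : ArithmeticFunction ℝ} (hg : g.IsMultiplicative)
    (hsq : ∀ n, ¬ Squarefree n → g n = 0) {M : ℕ} (hM : M ≠ 0) :
    ∑' n, (if M ∣ n then g n else 0) = g M * ∑' n, coprimeRestrict g M n := by
  have hsupp : Function.support (fun n => if M ∣ n then g n else 0) ⊆
      Set.range fun k => M * k := by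
    intro n hn
    obtain ⟨k, rfl⟩ : M ∣ n := by
      by_contra h
      simp [h] at hn
    exact ⟨k, rfl⟩
  rw [← (mul_right_injective₀ hM).tsum_eq hsupp, ← tsum_mul_left]
  refine tsum_congr fun k => ?_
  rw [if_pos (dvd_mul_right M k), coprimeRestrict_apply]
  split_ifs with h
  · exact hg.map_mul_of_coprime h
  · rw [mul_zero]
    exact hsq _ fun h' => h (Nat.coprime_of_squarefree_mul h')

theorem hasProd_primes_of_finset (s : Finset ℕ) (hs : ∀ p ∈ s, p.Prime) (c : ℕ → ℝ) :
    HasProd (fun p : Nat.Primes => if (p : ℕ) ∈ s then c p else 1) (∏ p ∈ s, c p) := by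
  have h : HasProd (fun p : ℕ => if p ∈ s then c p else 1) (∏ p ∈ s, c p) := by
    have h' := hasProd_prod_of_ne_finset_one (L := .unconditional ℕ) (s := s)
      (f := fun p : ℕ => if p ∈ s then c p else 1) fun p hp => if_neg hp
    rwa [Finset.prod_congr rfl fun p (hp : p ∈ s) => if_pos hp] at h'
  have hsupp : Function.mulSupport (fun p : ℕ => if p ∈ s then c p else 1) ⊆
      {p | Nat.Prime p} := by
    intro p hp
    by_contra hp'
    exact hp (if_neg fun hps => hp' (hs p hps))
  exact (hasProd_subtype_iff_of_mulSupport_subset hsupp).2 h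

theorem hasProd_tsum_multiples {g : ArithmeticFunction ℝ} (hg : g.IsMultiplicative)
    (hs : Summable fun n => ‖g n‖) (hsq : ∀ n, ¬ Squarefree n → g n = 0) {M : ℕ}
    (hM : Squarefree M) :
    HasProd (fun p : Nat.Primes => if (p : ℕ) ∣ M then g p else 1 + g p)
      (∑' n, if M ∣ n then g n else 0) := by
  rw [tsum_multiples_eq hg hsq hM.ne_zero, ← hg.prod_primeFactors hM]
  convert (hasProd_primes_of_finset M.primeFactors (fun p => Nat.prime_of_mem_primeFactors) g).mul
    (hasProd_one_add_of_isMultiplicative (isMultiplicative_coprimeRestrict hg M)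
      (summable_norm_coprimeRestrict hs M) fun n hn => ?_) using 2 with p
  · have hp : M.Coprime p ↔ ¬ (p : ℕ) ∣ M := by
      rw [Nat.coprime_comm, p.2.coprime_iff_not_dvd]
    by_cases h : (p : ℕ) ∣ M <;>
      simp [coprimeRestrict_apply, hp, h, p.2, hM.ne_zero]
  · simp [coprimeRestrict_apply, hsq n hn]

theorem le_two_mul_totient_sq (n : ℕ) :
    n ≤ 2 * n.totient ^ 2 ∧ (Odd n → n ≤ n.totient ^ 2) := by
  induction n using Nat.recOnPosPrimePosCoprime with
  | prime_pow p k hp hk =>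
    obtain ⟨k, rfl⟩ := Nat.exists_eq_succ_of_ne_zero hk.ne'
    rw [Nat.totient_prime_pow_succ hp, pow_succ]
    have h1 : p ^ k ≤ (p ^ k) ^ 2 := Nat.le_self_pow two_ne_zero _
    have h2 : 3 ≤ p → p ≤ (p - 1) ^ 2 := by
      intro h
      obtain ⟨q, rfl⟩ := Nat.exists_eq_add_of_le h
      rw [show 3 + q - 1 = q + 2 by lia]
      nlinarith
    have h3 : p ≤ 2 * (p - 1) ^ 2 := by
      rcases hp.two_le.eq_or_lt with rfl | h
      · norm_num
      · have := h2 h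
        lia
    refine ⟨?_, fun ho => ?_⟩
    · calc p ^ k * p ≤ (p ^ k) ^ 2 * (2 * (p - 1) ^ 2) := Nat.mul_le_mul h1 h3
        _ = _ := by ring
    · have hp2 : p ≠ 2 := by
        rintro rfl
        exact absurd (Nat.odd_mul.1 ho).2 (by decide)
      calc p ^ k * p ≤ (p ^ k) ^ 2 * (p - 1) ^ 2 :=
            Nat.mul_le_mul h1 (h2 (hp.two_le.lt_of_ne' hp2))
        _ = _ := by ring
  | zero => simp
  | one => simp
  | coprime a b ha hb hab iha ihb =>
    rw [Nat.totient_mul hab]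
    refine ⟨?_, fun ho => ?_⟩
    · rcases Nat.even_or_odd a with he | ho
      · have hob : Odd b := by
          rw [← Nat.not_even_iff_odd]
          intro heb
          exact Nat.not_coprime_of_dvd_of_dvd one_lt_two he.two_dvd heb.two_dvd hab
        calc a * b ≤ (2 * a.totient ^ 2) * b.totient ^ 2 := Nat.mul_le_mul iha.1 (ihb.2 hob)
          _ = _ := by ring
      · calc a * b ≤ a.totient ^ 2 * (2 * b.totient ^ 2) := Nat.mul_le_mul (iha.2 ho) ihb.1
          _ = _ := by ring
    · rw [Nat.odd_mul] at ho
      calc a * b ≤ a.totient ^ 2 * b.totient ^ 2 := Nat.mul_le_mul (iha.2 ho.1) (ihb.2 ho.2)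
        _ = _ := by ring

theorem summable_one_div_totient_mul_self :
    Summable fun n : ℕ => 1 / (n.totient * n : ℝ) := by
  have hs : Summable fun n : ℕ => 2 * (1 / (n : ℝ) ^ (3 / 2 : ℝ)) :=
    (Real.summable_one_div_nat_rpow.2 (by norm_num)).mul_left 2
  refine hs.of_nonneg_of_le (fun n => by positivity) fun n => ?_
  rcases n.eq_zero_or_pos with rfl | hn
  · simp
  have hn' : (0 : ℝ) < n := by exact_mod_cast hn
  have hφ : (0 : ℝ) < n.totient := by exact_mod_cast Nat.totient_pos.2 hn
  have hle : √(n : ℝ) ≤ 2 * n.totient := by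
    refine Real.sqrt_le_iff.2 ⟨by positivity, ?_⟩
    have : (n : ℝ) ≤ 2 * n.totient ^ 2 := by exact_mod_cast (le_two_mul_totient_sq n).1
    nlinarith [sq_nonneg (n.totient : ℝ)]
  have hpow : (n : ℝ) ^ (3 / 2 : ℝ) = √n * n := by
    rw [show (3 / 2 : ℝ) = 1 / 2 + 1 by norm_num, Real.rpow_add hn', Real.rpow_one,
      Real.sqrt_eq_rpow]
  rw [hpow, mul_one_div, div_le_div_iff₀ (by positivity) (by positivity)]
  nlinarith

/-- The arithmetic function `n ↦ gcd(n,h) / (φ(n)·n)`. -/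
noncomputable def wagstaffWeight (h : ℕ) : ArithmeticFunction ℝ :=
  ⟨fun n => (n.gcd h : ℝ) / (n.totient * n : ℝ), by simp⟩

theorem wagstaffWeight_apply (h n : ℕ) :
    wagstaffWeight h n = (n.gcd h : ℝ) / (n.totient * n : ℝ) := rfl

theorem isMultiplicative_wagstaffWeight (h : ℕ) : (wagstaffWeight h).IsMultiplicative := by
  refine ⟨by simp [wagstaffWeight_apply], fun {a b} hab => ?_⟩
  simp only [wagstaffWeight_apply, Nat.totient_mul hab, Nat.gcd_comm _ h, hab.gcd_mul h]
  push_cast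
  rw [div_mul_div_comm]
  ring

theorem wagstaffWeight_pos (h : ℕ) {n : ℕ} (hn : 0 < n) : 0 < wagstaffWeight h n := by
  have h1 : (0 : ℝ) < n.gcd h := by exact_mod_cast Nat.gcd_pos_of_pos_left h hn
  have h2 : (0 : ℝ) < n.totient := by exact_mod_cast Nat.totient_pos.2 hn
  have h3 : (0 : ℝ) < n := by exact_mod_cast hn
  rw [wagstaffWeight_apply]
  positivity

theorem wagstafff_eq_div (h : ℕ) {t : ℕ} (ht : 0 < t) (n : ℕ) :
    wagstafff h t n = wagstaffWeight h (n * t) / wagstaffWeight h t := by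
  have ht' : (t : ℝ) ≠ 0 := by exact_mod_cast ht.ne'
  rw [wagstafff, wagstaffWeight_apply, wagstaffWeight_apply, div_div_div_eq]
  push_cast
  rw [← mul_div_mul_right _ _ ht']
  ring

theorem wagstafff_mul (h : ℕ) {t : ℕ} (ht : 0 < t) {a b : ℕ} (hab : a.Coprime b) :
    wagstafff h t (a * b) = wagstafff h t a * wagstafff h t b := by
  have hW := (wagstaffWeight_pos h ht).ne'
  have key := (isMultiplicative_wagstaffWeight h).lcm_apply_mul_gcd_apply (x := a * t) (y := b * t)
  rw [Nat.lcm_mul_right, Nat.gcd_mul_right, hab.lcm_eq_mul, hab.gcd_eq_one, one_mul] at key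
  simp only [wagstafff_eq_div h ht]
  rw [div_mul_div_comm, ← key, mul_div_mul_right _ _ hW]

theorem wagstafff_nonneg (h t n : ℕ) : 0 ≤ wagstafff h t n := by
  rw [wagstafff]
  positivity

/-- The arithmetic function `n ↦ μ(n)·f_h(t,n)`. -/
noncomputable def moebiusMulWagstafff (h t : ℕ) : ArithmeticFunction ℝ :=
  ⟨fun n => (moebius n : ℝ) * wagstafff h t n, by simp⟩

theorem moebiusMulWagstafff_apply (h t n : ℕ) :
    moebiusMulWagstafff h t n = (moebius n : ℝ) * wagstafff h t n := rfl

theorem isMultiplicative_moebiusMulWagstafff (h : ℕ) {t : ℕ} (ht : 0 < t) :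
    (moebiusMulWagstafff h t).IsMultiplicative := by
  refine ⟨?_, fun {a b} hab => ?_⟩
  · rw [moebiusMulWagstafff_apply, wagstafff_eq_div h ht, one_mul,
      div_self (wagstaffWeight_pos h ht).ne']
    simp
  · simp only [moebiusMulWagstafff_apply, wagstafff_mul h ht hab,
      isMultiplicative_moebius.map_mul_of_coprime hab]
    push_cast
    ring

theorem moebiusMulWagstafff_eq_zero (h t : ℕ) {n : ℕ} (hn : ¬ Squarefree n) :
    moebiusMulWagstafff h t n = 0 := by
  simp [moebiusMulWagstafff_apply, moebius_eq_zero_of_not_squarefree hn]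

theorem moebiusMulWagstafff_prime (h t : ℕ) {p : ℕ} (hp : p.Prime) :
    moebiusMulWagstafff h t p = -wagstafff h t p := by
  simp [moebiusMulWagstafff_apply, moebius_apply_prime hp]

theorem wagstafff_le {h t : ℕ} (hh : 0 < h) (ht : 0 < t) (n : ℕ) :
    wagstafff h t n ≤ h * t.totient * (1 / (n.totient * n : ℝ)) := by
  rcases n.eq_zero_or_pos with rfl | hn
  · simp [wagstafff]
  have h1 : ((n * t).gcd h : ℝ) ≤ h := by exact_mod_cast Nat.gcd_le_right _ hh
  have h2 : (1 : ℝ) ≤ t.gcd h := by exact_mod_cast Nat.gcd_pos_of_pos_left h ht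
  have h3 : (n.totient : ℝ) ≤ (n * t).totient := by
    exact_mod_cast Nat.le_of_dvd (Nat.totient_pos.2 (Nat.mul_pos hn ht))
      (Nat.totient_dvd_of_dvd (dvd_mul_right n t))
  have h4 : (0 : ℝ) < n.totient := by exact_mod_cast Nat.totient_pos.2 hn
  have h5 : (0 : ℝ) < n := by exact_mod_cast hn
  rw [wagstafff, mul_one_div]
  have h6 : (n.totient : ℝ) ≤ t.gcd h * (n * t).totient := by nlinarith
  gcongr

theorem summable_norm_moebiusMulWagstafff {h t : ℕ} (hh : 0 < h) (ht : 0 < t) :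
    Summable fun n => ‖moebiusMulWagstafff h t n‖ := by
  refine (summable_one_div_totient_mul_self.mul_left (h * t.totient : ℝ)).of_nonneg_of_le
    (fun _ => norm_nonneg _) fun n => ?_
  rw [moebiusMulWagstafff_apply, norm_mul, Real.norm_of_nonneg (wagstafff_nonneg h t n)]
  have hμ : ‖(moebius n : ℝ)‖ ≤ 1 := by
    rw [Real.norm_eq_abs]
    exact_mod_cast abs_moebius_le_one
  exact (mul_le_of_le_one_left (wagstafff_nonneg h t n) hμ).trans (wagstafff_le hh ht n)

theorem Nat.dvd_mul_iff_div_gcd_dvd {m : ℕ} (hm : 0 < m) (n t : ℕ) :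
    m ∣ n * t ↔ m / m.gcd t ∣ n := by
  have hg : 0 < m.gcd t := Nat.gcd_pos_of_pos_left t hm
  rw [← (Nat.coprime_div_gcd_div_gcd hg).dvd_mul_right,
    ← Nat.mul_dvd_mul_iff_right hg (a := m / m.gcd t), mul_assoc,
    Nat.div_mul_cancel (Nat.gcd_dvd_left m t), Nat.div_mul_cancel (Nat.gcd_dvd_right m t)]

theorem wagstaffTerm_eq (h : ℕ) {m t : ℕ} (hm : 0 < m) (ht : 0 < t) (n : ℕ) :
    wagstaffTerm h m t n = wagstaffWeight h t *
      (if m / m.gcd t ∣ n then moebiusMulWagstafff h t n else 0) := by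
  rw [wagstaffTerm]
  simp only [Nat.dvd_mul_iff_div_gcd_dvd hm]
  split_ifs
  · rw [moebiusMulWagstafff_apply, wagstafff_eq_div h ht,
      mul_left_comm (wagstaffWeight h t),
      mul_div_cancel₀ _ (wagstaffWeight_pos h ht).ne', wagstaffWeight_apply]
    push_cast
    ring
  · simp

theorem wagstafff_of_not_dvd (h : ℕ) {t p : ℕ} (ht : 0 < t) (hp : p.Prime) (hpt : ¬ p ∣ t) :
    wagstafff h t p = (p.gcd h : ℝ) / ((p : ℝ) * ((p : ℝ) - 1)) := by
  have hco := (hp.coprime_iff_not_dvd).2 hpt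
  rw [wagstafff_eq_div h ht, (isMultiplicative_wagstaffWeight h).map_mul_of_coprime hco,
    mul_div_cancel_right₀ _ (wagstaffWeight_pos h ht).ne', wagstaffWeight_apply,
    Nat.totient_prime hp, Nat.cast_pred hp.pos, mul_comm (p : ℝ)]

theorem wagstafff_of_dvd (h : ℕ) {t p : ℕ} (ht : 0 < t) (hp : p.Prime) (hpt : p ∣ t) :
    wagstafff h t p = ((p * t).gcd h : ℝ) / ((p : ℝ) ^ 2 * t.gcd h) := by
  have hφ : (t.totient : ℝ) ≠ 0 := by exact_mod_cast (Nat.totient_pos.2 ht).ne'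
  rw [wagstafff, Nat.totient_mul_of_prime_of_dvd hp hpt,
    ← mul_div_mul_right _ ((p : ℝ) ^ 2 * t.gcd h) hφ]
  push_cast
  ring

theorem wagstafff_prime_pos {h t p : ℕ} (ht : 0 < t) (hp : p.Prime) : 0 < wagstafff h t p := by
  rw [wagstafff_eq_div h ht]
  exact div_pos (wagstaffWeight_pos h (Nat.mul_pos hp.pos ht)) (wagstaffWeight_pos h ht)

theorem gcd_div_lt_one (h : ℕ) {p : ℕ} (hp2 : 2 < p) :
    (p.gcd h : ℝ) / ((p : ℝ) * ((p : ℝ) - 1)) < 1 := by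
  have h1 : (p.gcd h : ℝ) ≤ p := by exact_mod_cast Nat.gcd_le_left h (by lia)
  have h2 : (2 : ℝ) < p := by exact_mod_cast hp2
  rw [div_lt_one (by nlinarith)]
  nlinarith

theorem wagstafff_prime_lt_one (h : ℕ) {t p : ℕ} (ht : 0 < t) (hp : p.Prime) (hp2 : 2 < p) :
    wagstafff h t p < 1 := by
  by_cases hpt : p ∣ t
  · have h2 : (2 : ℝ) < p := by exact_mod_cast hp2
    have hg : 0 < t.gcd h := Nat.gcd_pos_of_pos_left h ht
    have hg' : (0 : ℝ) < t.gcd h := by exact_mod_cast hg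
    have h1 : ((p * t).gcd h : ℝ) ≤ p * t.gcd h := by
      exact_mod_cast Nat.le_of_dvd (Nat.mul_pos hp.pos hg)
        (Nat.dvd_trans (Nat.gcd_dvd_gcd_mul_left_right _ _ p) (Nat.gcd_mul_left p t h).dvd)
    rw [wagstafff_of_dvd h ht hp hpt, div_lt_one (by positivity)]
    nlinarith [mul_pos hg' (by linarith : (0 : ℝ) < p)]
  · rw [wagstafff_of_not_dvd h ht hp hpt]
    exact gcd_div_lt_one h hp2

theorem hasProd_artinConstant :
    HasProd (fun p : Nat.Primes => 1 - 1 / ((p : ℝ) * ((p : ℝ) - 1))) artinConstant := by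
  have h := hasProd_one_add_of_isMultiplicative
    (isMultiplicative_moebiusMulWagstafff 1 one_pos)
    (summable_norm_moebiusMulWagstafff one_pos one_pos)
    fun n hn => moebiusMulWagstafff_eq_zero 1 1 hn
  have hloc (p : Nat.Primes) :
      1 + moebiusMulWagstafff 1 1 p = 1 - 1 / ((p : ℝ) * ((p : ℝ) - 1)) := by
    rw [moebiusMulWagstafff_prime 1 1 p.2, wagstafff_of_not_dvd 1 one_pos p.2 p.2.not_dvd_one,
      Nat.gcd_one_right, Nat.cast_one, ← sub_eq_add_neg]
  simp only [hloc] at h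
  exact h.multipliable.hasProd

theorem artin_factor_mul_wagstaffB_factor (h : ℕ) {p : ℕ} (hp : p.Prime) (hp2 : 2 < p) :
    (1 - 1 / ((p : ℝ) * ((p : ℝ) - 1))) *
        (if p ∣ h then 1 - ((p : ℝ) - 1) / ((p : ℝ) ^ 2 - (p : ℝ) - 1) else 1) =
      1 - (p.gcd h : ℝ) / ((p : ℝ) * ((p : ℝ) - 1)) := by
  split_ifs with hph
  · have h2 : (2 : ℝ) < p := by exact_mod_cast hp2
    have h3 : (p : ℝ) - 1 ≠ 0 := by linarith
    have h4 : (p : ℝ) ^ 2 - p - 1 ≠ 0 := by nlinarith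
    rw [Nat.gcd_eq_left hph]
    have h5 : (p : ℝ) ≠ 0 := by linarith
    rw [one_sub_div (mul_ne_zero h5 h3), one_sub_div h4, one_sub_div (mul_ne_zero h5 h3),
      show (p : ℝ) * (p - 1) - 1 = p ^ 2 - p - 1 by ring, div_mul_div_comm,
      mul_comm ((p : ℝ) ^ 2 - p - 1), mul_div_mul_right _ _ h4]
    ring
  · rw [(hp.coprime_iff_not_dvd.2 hph).gcd_eq_one]
    simp

theorem one_sub_mul_one_sub_one_div_inv {x : ℝ} (hx0 : x ≠ 0) (hx1 : x ≠ 1) :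
    (1 - x) * (1 - 1 / x)⁻¹ = -x := by
  have h : x - 1 ≠ 0 := sub_ne_zero.2 hx1
  rw [one_sub_div hx0, inv_div, mul_div_assoc', div_eq_iff h]
  ring

theorem wagstaff_local_factor {h M t p : ℕ} (hh : 0 < h) (hM : M ≠ 0) (ht : 0 < t)
    (hp : p.Prime) :
    (1 - 1 / ((p : ℝ) * ((p : ℝ) - 1))) *
      (if p ∈ ({2} : Finset ℕ) then
        2 * (if 2 ∣ M then -(wagstafff h t 2) else 1 - wagstafff h t 2) else 1) *
      (if p ∈ h.primeFactors.filter (fun p => 2 < p) then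
        1 - ((p : ℝ) - 1) / ((p : ℝ) ^ 2 - (p : ℝ) - 1) else 1) *
      (if p ∈ t.primeFactors.filter (fun p => 2 < p) then
        (1 - ((p * t).gcd h : ℝ) / ((p : ℝ) ^ 2 * t.gcd h)) *
          (1 - (p.gcd h : ℝ) / ((p : ℝ) * ((p : ℝ) - 1)))⁻¹ else 1) *
      (if p ∈ M.primeFactors.filter (fun p => 2 < p) then
        (1 - 1 / wagstafff h t p)⁻¹ else 1) =
    if p ∣ M then -wagstafff h t p else 1 - wagstafff h t p := by
  rcases hp.two_le.eq_or_lt with rfl | hp2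
  · norm_num
    split_ifs <;> ring
  simp only [Finset.mem_singleton, hp2.ne', if_false, mul_one, Finset.mem_filter, hp2, and_true,
    Nat.mem_primeFactors, hp, true_and, hh.ne', hM, ht.ne', ne_eq, not_false_eq_true,
    artin_factor_mul_wagstaffB_factor h hp hp2]
  have ht_factor : (1 - (p.gcd h : ℝ) / ((p : ℝ) * ((p : ℝ) - 1))) *
      (if p ∣ t then (1 - ((p * t).gcd h : ℝ) / ((p : ℝ) ^ 2 * t.gcd h)) *
        (1 - (p.gcd h : ℝ) / ((p : ℝ) * ((p : ℝ) - 1)))⁻¹ else 1) = 1 - wagstafff h t p := by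
    split_ifs with hpt
    · rw [mul_left_comm, mul_inv_cancel₀ (sub_pos.2 (gcd_div_lt_one h hp2)).ne', mul_one,
        wagstafff_of_dvd h ht hp hpt]
    · rw [mul_one, wagstafff_of_not_dvd h ht hp hpt]
  rw [ht_factor]
  split_ifs
  · exact one_sub_mul_one_sub_one_div_inv (wagstafff_prime_pos ht hp).ne'
      (wagstafff_prime_lt_one h ht hp hp2).ne
  · rw [mul_one]

theorem tsum_multiples_moebiusMulWagstafff {h M t : ℕ} (hh : 0 < h) (ht : 0 < t)
    (hM : Squarefree M) :
    ∑' n, (if M ∣ n then moebiusMulWagstafff h t n else 0) =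
      artinConstant *
        (2 * (if 2 ∣ M then -(wagstafff h t 2) else 1 - wagstafff h t 2)) *
        (∏ p ∈ h.primeFactors.filter (fun p => 2 < p),
          (1 - ((p : ℝ) - 1) / ((p : ℝ) ^ 2 - (p : ℝ) - 1))) *
        (∏ p ∈ t.primeFactors.filter (fun p => 2 < p),
          (1 - ((p * t).gcd h : ℝ) / ((p : ℝ) ^ 2 * t.gcd h)) *
            (1 - (p.gcd h : ℝ) / ((p : ℝ) * ((p : ℝ) - 1)))⁻¹) *
        ∏ p ∈ M.primeFactors.filter (fun p => 2 < p), (1 - 1 / wagstafff h t p)⁻¹ := by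
  have hprime (n : ℕ) : ∀ p ∈ n.primeFactors.filter (fun p => 2 < p), p.Prime := fun p hp =>
    Nat.prime_of_mem_primeFactors (Finset.mem_filter.1 hp).1
  have htwo : ∀ p ∈ ({2} : Finset ℕ), p.Prime := by simp [Nat.prime_two]
  have hL := hasProd_tsum_multiples (isMultiplicative_moebiusMulWagstafff h ht)
    (summable_norm_moebiusMulWagstafff hh ht) (fun n hn => moebiusMulWagstafff_eq_zero h t hn) hM
  have hR := (((hasProd_artinConstant.mul (hasProd_primes_of_finset {2} htwo
    fun _ => 2 * (if 2 ∣ M then -(wagstafff h t 2) else 1 - wagstafff h t 2))).mul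
    (hasProd_primes_of_finset _ (hprime h)
      fun p => 1 - ((p : ℝ) - 1) / ((p : ℝ) ^ 2 - (p : ℝ) - 1))).mul
    (hasProd_primes_of_finset _ (hprime t)
      fun p => (1 - ((p * t).gcd h : ℝ) / ((p : ℝ) ^ 2 * t.gcd h)) *
        (1 - (p.gcd h : ℝ) / ((p : ℝ) * ((p : ℝ) - 1)))⁻¹)).mul
    (hasProd_primes_of_finset _ (hprime M) fun p => (1 - 1 / wagstafff h t p)⁻¹)
  rw [Finset.prod_singleton] at hR
  refine hL.unique ?_
  convert hR using 2 with p
  rw [wagstaff_local_factor hh hM.ne_zero ht p.2, moebiusMulWagstafff_prime h t p.2,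
    ← sub_eq_add_neg]

/-- The Wagstaff sum `S_{h,m}(t) = ∑_{n ≥ 1, m ∣ nt} μ(n)·gcd(nt,h)/(φ(nt)·nt)` converges
absolutely and equals `A·B_h·F_h(t)·G_{h,m}(t)`. -/
theorem wagstaff_sum_eq (h m t : ℕ) (hh : 0 < h) (hm : 0 < m) (ht : 0 < t) :
    Summable (fun n : ℕ => |wagstaffTerm h m t n|) ∧
      ∑' n : ℕ, wagstaffTerm h m t n =
        artinConstant * wagstaffB h * wagstaffFfun h t * wagstaffG h m t := by
  simp only [wagstaffTerm_eq h hm ht, wagstaffG, tsum_mul_left]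
  generalize m / m.gcd t = M
  constructor
  · refine ((summable_norm_moebiusMulWagstafff hh ht).mul_left
      (wagstaffWeight h t)).of_nonneg_of_le (fun _ => abs_nonneg _) fun n => ?_
    rw [abs_mul, abs_of_pos (wagstaffWeight_pos h ht)]
    refine mul_le_mul_of_nonneg_left ?_ (wagstaffWeight_pos h ht).le
    split_ifs <;> simp
  · by_cases hM : Squarefree M
    · have hμ : |(moebius M : ℝ)| = 1 := by exact_mod_cast abs_moebius_eq_one_of_squarefree hM
      rw [tsum_multiples_moebiusMulWagstafff hh ht hM, wagstaffB, wagstaffFfun, wagstaffGtilde,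
        hμ, wagstaffWeight_apply]
      ring
    · have hzero (n : ℕ) : (if M ∣ n then moebiusMulWagstafff h t n else 0) = 0 := by
        split_ifs with hn
        · exact moebiusMulWagstafff_eq_zero h t fun hsq => hM (hsq.squarefree_of_dvd hn)
        · rfl
      simp [hzero, wagstaffGtilde, moebius_eq_zero_of_not_squarefree hM]
end
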